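/- Run IREG-PRM⁺ in self-play on the zero-sum game max_{x ∈ Δ(m)} min_{y ∈ Δ(n)} xᵀAy, and suppose ‖r̃_𝒳^(1)‖₂ ≥ δ and ‖r̃_𝒴^(1)‖₂ ≥ δ for some δ > 0. Then there exists a constant C ≥ 0, independent of T, such that for every T, Σ_{t=1}^T (‖x^(t) − x̃^(t)‖₂² + ‖y^(t) − ỹ^(t)‖₂²) ≤ C (bounded second-order path length). -/

import Mathlib

open Matrix

/-- ℓ₂ norm of a vector in ℝ^d. -/
noncomputable def l2 {d : ℕ} (v : Fin d → ℝ) : ℝ := Real.sqrt (∑ i, (v i) ^ 2)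

/-- ℓ₁ norm of a vector in ℝ^d. -/
def l1 {d : ℕ} (v : Fin d → ℝ) : ℝ := ∑ i, |v i|

/-- Standard inner product on ℝ^d. -/
def dotp {d : ℕ} (v w : Fin d → ℝ) : ℝ := ∑ i, v i * w i

/-- Coordinatewise positive part `[v]⁺`. -/
def ppart {d : ℕ} (v : Fin d → ℝ) : Fin d → ℝ := fun i => max (v i) 0

/-- A run of the IR-PRM⁺ algorithm on the simplex `Δ(n)`, with utilities `u`,
predictions `m`, regret vectors `rt` (`r̃`) and `r`, normalization constants
`gam` (`γ`), and strategies `x`, `xt` (`x̃`); `g` is the shifted utility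
increment.  All quantities are indexed starting from time `1`. -/
structure IRPRMp (n : ℕ) where
  u : ℕ → Fin n → ℝ
  m : ℕ → Fin n → ℝ
  rt : ℕ → Fin n → ℝ
  gam : ℕ → ℝ
  r : ℕ → Fin n → ℝ
  x : ℕ → Fin n → ℝ
  xt : ℕ → Fin n → ℝ
  g : ℕ → Fin n → ℝ
  rt1_nonneg : ∀ i, 0 ≤ rt 1 i
  xt1_mem : rt 1 = 0 → xt 1 ∈ stdSimplex ℝ (Fin n)
  xt1_eq : rt 1 ≠ 0 → xt 1 = (l1 (rt 1))⁻¹ • rt 1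
  zero_case : ∀ t, 1 ≤ t → rt t = 0 →
      m t = 0 ∧ gam t = 0 ∧ r t = 0 ∧ x t = xt t
  gam_spec : ∀ t, 1 ≤ t → rt t ≠ 0 →
      l2 (ppart (rt t + m t - gam t • (1 : Fin n → ℝ))) = l2 (rt t)
  r_def : ∀ t, 1 ≤ t → rt t ≠ 0 →
      r t = rt t + m t - gam t • (1 : Fin n → ℝ)
  x_def : ∀ t, 1 ≤ t → rt t ≠ 0 →
      x t = (l1 (ppart (r t)))⁻¹ • ppart (r t)
  g_def : ∀ t, 1 ≤ t →
      g t = u t - m t - (dotp (u t - m t) (x t)) • (1 : Fin n → ℝ)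
  rt_succ : ∀ t, 1 ≤ t → rt (t + 1) = ppart (r t + g t)
  xt_succ_ne : ∀ t, 1 ≤ t → rt (t + 1) ≠ 0 →
      xt (t + 1) = (l1 (rt (t + 1)))⁻¹ • rt (t + 1)
  xt_succ_zero : ∀ t, 1 ≤ t → rt (t + 1) = 0 → xt (t + 1) = x t

/-- Coordinatewise extragradient three-point inequality for projections onto `[0, ∞)`. -/
lemma extragradient_coord {R b g z : ℝ} (hz : 0 ≤ z) :
    2 * ((b + g) * (z - max (R + b) 0)) ≤
      (z - R) ^ 2 - (z - max (R + b + g) 0) ^ 2 - (max (R + b) 0 - R) ^ 2 + g ^ 2 := by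
  rcases max_cases (R + b) 0 with ⟨h1, h1'⟩ | ⟨h1, h1'⟩ <;>
  rcases max_cases (R + b + g) 0 with ⟨h2, h2'⟩ | ⟨h2, h2'⟩ <;> rw [h1, h2]
  · nlinarith
  · nlinarith [mul_nonneg hz (by linarith : 0 ≤ -(R + b + g)), sq_nonneg (R + b + g)]
  · nlinarith [mul_nonneg h2' (by linarith : 0 ≤ -(R + b)), sq_nonneg (R + b)]
  · nlinarith [mul_nonneg hz (by linarith : 0 ≤ -(R + b + g)), sq_nonneg g]

lemma l2_sq {d : ℕ} (v : Fin d → ℝ) : l2 v ^ 2 = ∑ i, v i ^ 2 :=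
  Real.sq_sqrt (Finset.sum_nonneg fun _ _ => sq_nonneg _)

lemma sum_sq_le_sq_sum {d : ℕ} {w : Fin d → ℝ} (hw : ∀ i, 0 ≤ w i) :
    ∑ i, w i ^ 2 ≤ (∑ i, w i) ^ 2 :=
  Finset.sum_sq_le_sq_sum_of_nonneg fun i _ => hw i

lemma sum_sq_le_one {d : ℕ} {p : Fin d → ℝ} (hp : p ∈ stdSimplex ℝ (Fin d)) :
    ∑ i, p i ^ 2 ≤ 1 := by
  simpa [hp.2] using sum_sq_le_sq_sum hp.1

lemma sum_sq_mulVec_le {m n : ℕ} (A : Matrix (Fin m) (Fin n) ℝ) (v : Fin n → ℝ) :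
    ∑ i, (A *ᵥ v) i ^ 2 ≤ (∑ i, ∑ j, A i j ^ 2) * ∑ j, v j ^ 2 := by
  rw [Finset.sum_mul]
  exact Finset.sum_le_sum fun i _ => Finset.sum_mul_sq_le_sq_mul_sq Finset.univ (A i) v

/-- Centering a utility vector at a mixed strategy increases its squared norm by a bounded
factor. -/
lemma sum_sq_centered_le {d : ℕ} {p : Fin d → ℝ} (hp : p ∈ stdSimplex ℝ (Fin d))
    (v : Fin d → ℝ) :
    ∑ i, (v i - dotp v p) ^ 2 ≤ (2 + 2 * d) * ∑ i, v i ^ 2 := by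
  have h1 : dotp v p ^ 2 ≤ ∑ i, v i ^ 2 :=
    (Finset.sum_mul_sq_le_sq_mul_sq _ v p).trans <|
      mul_le_of_le_one_right (Finset.sum_nonneg fun _ _ => sq_nonneg _) (sum_sq_le_one hp)
  calc ∑ i, (v i - dotp v p) ^ 2 ≤ ∑ i, (2 * v i ^ 2 + 2 * dotp v p ^ 2) :=
        Finset.sum_le_sum fun i _ => by nlinarith [sq_nonneg (v i + dotp v p)]
    _ = 2 * ∑ i, v i ^ 2 + 2 * d * dotp v p ^ 2 := by
        rw [Finset.sum_add_distrib, ← Finset.mul_sum]; simp; ring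
    _ ≤ _ := by
        have : (0 : ℝ) ≤ d := d.cast_nonneg
        nlinarith

/-- Normalizing onto the simplex is Lipschitz away from the origin. -/
lemma sum_sq_normalize_sub_le {d : ℕ} {w R : Fin d → ℝ} (hR : ∀ i, 0 ≤ R i)
    (hw0 : 0 < ∑ i, w i) (hR0 : 0 < ∑ i, R i) :
    (∑ i, w i) ^ 2 * ∑ i, ((∑ j, w j)⁻¹ * w i - (∑ j, R j)⁻¹ * R i) ^ 2 ≤
      (2 + 2 * d) * ∑ i, (w i - R i) ^ 2 := by
  set a := ∑ i, w i
  set b := ∑ i, R i with hb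
  have hq : ∑ i, (b⁻¹ * R i) ^ 2 ≤ 1 := by
    refine sum_sq_le_one (p := fun i => b⁻¹ * R i) ⟨fun i => by have := hR i; positivity, ?_⟩
    rw [← Finset.mul_sum, ← hb, inv_mul_cancel₀ hR0.ne']
  have hD : (a - b) ^ 2 ≤ d * ∑ i, (w i - R i) ^ 2 := by
    have := sq_sum_le_card_mul_sum_sq (s := Finset.univ) (f := fun i => w i - R i)
    rw [Finset.sum_sub_distrib] at this
    simpa using this
  calc a ^ 2 * ∑ i, (a⁻¹ * w i - b⁻¹ * R i) ^ 2
      = ∑ i, ((w i - R i) - (b⁻¹ * R i) * (a - b)) ^ 2 := by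
        rw [Finset.mul_sum]
        refine Finset.sum_congr rfl fun i _ => ?_
        field_simp
        ring
    _ ≤ ∑ i, (2 * (w i - R i) ^ 2 + 2 * (a - b) ^ 2 * (b⁻¹ * R i) ^ 2) :=
        Finset.sum_le_sum fun i _ => by
          nlinarith [sq_nonneg ((w i - R i) + (b⁻¹ * R i) * (a - b))]
    _ = 2 * ∑ i, (w i - R i) ^ 2 + 2 * (a - b) ^ 2 * ∑ i, (b⁻¹ * R i) ^ 2 := by
        rw [Finset.sum_add_distrib, ← Finset.mul_sum, ← Finset.mul_sum]
    _ ≤ 2 * ∑ i, (w i - R i) ^ 2 + 2 * (a - b) ^ 2 * 1 := by gcongr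
    _ ≤ _ := by linarith

namespace IRPRMp

variable {d : ℕ} (alg : IRPRMp d)

lemma rt_nonneg {t : ℕ} (ht : 1 ≤ t) (i : Fin d) : 0 ≤ alg.rt t i := by
  induction t, ht using Nat.le_induction with
  | base => exact alg.rt1_nonneg i
  | succ t ht _ => rw [alg.rt_succ t ht]; exact le_max_right _ _

lemma sum_rt_pos {t : ℕ} (ht : 1 ≤ t) (h0 : alg.rt t ≠ 0) : 0 < ∑ i, alg.rt t i := by
  obtain ⟨i, hi⟩ := Function.ne_iff.1 h0
  exact Finset.sum_pos' (fun i _ => alg.rt_nonneg ht i)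
    ⟨i, Finset.mem_univ i, (alg.rt_nonneg ht i).lt_of_ne' hi⟩

lemma xt_eq {t : ℕ} (ht : 1 ≤ t) (h0 : alg.rt t ≠ 0) (i : Fin d) :
    alg.xt t i = (∑ j, alg.rt t j)⁻¹ * alg.rt t i := by
  have h : alg.xt t = (l1 (alg.rt t))⁻¹ • alg.rt t := by
    obtain rfl | ⟨s, hs, rfl⟩ : t = 1 ∨ ∃ s, 1 ≤ s ∧ t = s + 1 := by
      rcases ht.eq_or_lt with h | h
      · exact .inl h.symm
      · exact .inr ⟨t - 1, by omega, by omega⟩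
    · exact alg.xt1_eq h0
    · exact alg.xt_succ_ne s hs h0
  simp [h, l1, abs_of_nonneg (alg.rt_nonneg ht _)]

lemma sum_sq_ppart_r {t : ℕ} (ht : 1 ≤ t) (h0 : alg.rt t ≠ 0) :
    ∑ i, ppart (alg.r t) i ^ 2 = ∑ i, alg.rt t i ^ 2 := by
  rw [← l2_sq, ← l2_sq, alg.r_def t ht h0, alg.gam_spec t ht h0]

lemma sum_ppart_r_pos {t : ℕ} (ht : 1 ≤ t) (h0 : alg.rt t ≠ 0) :
    0 < ∑ i, ppart (alg.r t) i := by
  have hnn : ∀ i, 0 ≤ ppart (alg.r t) i := fun i => le_max_right _ _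
  refine (Finset.sum_nonneg fun i _ => hnn i).lt_of_ne' fun h => h0 ?_
  have h1 := sum_sq_le_sq_sum hnn
  rw [h, alg.sum_sq_ppart_r ht h0] at h1
  have h2 := (Finset.sum_eq_zero_iff_of_nonneg fun i _ => sq_nonneg (alg.rt t i)).1
    (le_antisymm (by simpa using h1) (Finset.sum_nonneg fun i _ => sq_nonneg _))
  ext i
  simpa using h2 i (Finset.mem_univ i)

lemma x_eq {t : ℕ} (ht : 1 ≤ t) (h0 : alg.rt t ≠ 0) (i : Fin d) :
    alg.x t i = (∑ j, ppart (alg.r t) j)⁻¹ * ppart (alg.r t) i := by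
  have hnn : ∀ i, |ppart (alg.r t) i| = ppart (alg.r t) i :=
    fun i => abs_of_nonneg (le_max_right _ _)
  simp [alg.x_def t ht h0, l1, hnn]

lemma x_mem {t : ℕ} (ht : 1 ≤ t) (h0 : alg.rt t ≠ 0) : alg.x t ∈ stdSimplex ℝ (Fin d) := by
  have ha := alg.sum_ppart_r_pos ht h0
  constructor
  · intro i
    rw [alg.x_eq ht h0]
    exact mul_nonneg (inv_nonneg.2 ha.le) (le_max_right _ _)
  · simp_rw [alg.x_eq ht h0, ← Finset.mul_sum]
    exact inv_mul_cancel₀ ha.ne'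

lemma sum_g_mul_ppart_r {t : ℕ} (ht : 1 ≤ t) (h0 : alg.rt t ≠ 0) :
    ∑ i, alg.g t i * ppart (alg.r t) i = 0 := by
  have ha := alg.sum_ppart_r_pos ht h0
  have h1 : ∀ i, ppart (alg.r t) i = (∑ j, ppart (alg.r t) j) * alg.x t i := fun i => by
    rw [alg.x_eq ht h0, mul_inv_cancel_left₀ ha.ne']
  have h2 : ∑ i, alg.g t i * alg.x t i = 0 := by
    have h3 := (alg.x_mem ht h0).2
    simp only [alg.g_def t ht, Pi.sub_apply, Pi.smul_apply, Pi.one_apply, smul_eq_mul, mul_one,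
      sub_mul _ (dotp _ _), Finset.sum_sub_distrib, ← Finset.mul_sum, h3]
    simp [dotp]
  calc _ = ∑ i, (∑ j, ppart (alg.r t) j) * (alg.g t i * alg.x t i) :=
        Finset.sum_congr rfl fun i _ => by rw [mul_left_comm, ← h1 i]
    _ = 0 := by rw [← Finset.mul_sum, h2, mul_zero]

/-- The squared norm of the regret vector never decreases. -/
lemma sum_sq_rt_le_succ {t : ℕ} (ht : 1 ≤ t) (h0 : alg.rt t ≠ 0) :
    ∑ i, alg.rt t i ^ 2 ≤ ∑ i, alg.rt (t + 1) i ^ 2 := by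
  have h1 : ∑ i, (ppart (alg.r t) i ^ 2 + 2 * (alg.g t i * ppart (alg.r t) i)) ≤
      ∑ i, alg.rt (t + 1) i ^ 2 := by
    refine Finset.sum_le_sum fun i _ => ?_
    rw [alg.rt_succ t ht]
    simp only [ppart, Pi.add_apply]
    rcases max_cases (alg.r t i) 0 with ⟨h, h'⟩ | ⟨h, h'⟩ <;> rw [h]
    · rcases max_cases (alg.r t i + alg.g t i) 0 with ⟨k, k'⟩ | ⟨k, k'⟩ <;> rw [k] <;>
        nlinarith [sq_nonneg (alg.g t i)]
    · nlinarith [sq_nonneg (max (alg.r t i + alg.g t i) 0)]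
  rwa [Finset.sum_add_distrib, ← Finset.mul_sum, alg.sum_g_mul_ppart_r ht h0, mul_zero, add_zero,
    alg.sum_sq_ppart_r ht h0] at h1

lemma ne_zero_of_le_sum_sq {v : Fin d → ℝ} {δ : ℝ} (hδ : 0 < δ) (h : δ ^ 2 ≤ ∑ i, v i ^ 2) :
    v ≠ 0 := by
  rintro rfl
  simp only [Pi.zero_apply, ne_eq, OfNat.ofNat_ne_zero, not_false_eq_true, zero_pow,
    Finset.sum_const_zero] at h
  nlinarith [pow_pos hδ 2]

lemma sq_le_sum_sq_rt {δ : ℝ} (hδ : 0 < δ) (hinit : δ ≤ l2 (alg.rt 1)) {t : ℕ} (ht : 1 ≤ t) :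
    δ ^ 2 ≤ ∑ i, alg.rt t i ^ 2 := by
  induction t, ht using Nat.le_induction with
  | base => rw [← l2_sq]; gcongr
  | succ t ht ih => exact ih.trans (alg.sum_sq_rt_le_succ ht (ne_zero_of_le_sum_sq hδ ih))

/-- One-step regret inequality, with the residual of the normalization step on the left. -/
lemma regret_step {t : ℕ} (ht : 1 ≤ t) (h0 : alg.rt t ≠ 0) {p : Fin d → ℝ}
    (hp : p ∈ stdSimplex ℝ (Fin d)) {c : ℝ} (hc : 0 ≤ c) :
    2 * c * (dotp (alg.u t) p - dotp (alg.u t) (alg.x t)) +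
        c * (∑ i, ppart (alg.r t) i)⁻¹ * ∑ i, (ppart (alg.r t) i - alg.rt t i) ^ 2 ≤
      ∑ i, (c * p i - alg.rt t i) ^ 2 - ∑ i, (c * p i - alg.rt (t + 1) i) ^ 2 +
        ∑ i, alg.g t i ^ 2 := by
  have ha := alg.sum_ppart_r_pos ht h0
  have hr : ∀ i, alg.r t i = alg.rt t i + (alg.m t i - alg.gam t) := fun i => by
    simp [alg.r_def t ht h0]; ring
  have hg : ∀ i, alg.g t i = alg.u t i - alg.m t i - dotp (alg.u t - alg.m t) (alg.x t) :=
    fun i => by simp [alg.g_def t ht]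
  have hx := alg.x_mem ht h0
  have key : ∑ i, 2 * ((alg.m t i - alg.gam t + alg.g t i) * (c * p i - ppart (alg.r t) i)) ≤
      ∑ i, ((c * p i - alg.rt t i) ^ 2 - (c * p i - alg.rt (t + 1) i) ^ 2 -
        (ppart (alg.r t) i - alg.rt t i) ^ 2 + alg.g t i ^ 2) := by
    refine Finset.sum_le_sum fun i _ => ?_
    rw [alg.rt_succ t ht]
    simp only [ppart, Pi.add_apply, hr]
    exact extragradient_coord (mul_nonneg hc (hp.1 i))
  have hres : 2 * ∑ i, (alg.m t i - alg.gam t) * ppart (alg.r t) i =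
      ∑ i, (ppart (alg.r t) i - alg.rt t i) ^ 2 := by
    have h1 : ∀ i, (ppart (alg.r t) i - alg.rt t i) ^ 2 =
        2 * ((alg.m t i - alg.gam t) * ppart (alg.r t) i) +
          (alg.rt t i ^ 2 - ppart (alg.r t) i ^ 2) := fun i => by
      have h2 : ppart (alg.r t) i * ppart (alg.r t) i = alg.r t i * ppart (alg.r t) i := by
        simp only [ppart]
        rcases max_cases (alg.r t i) 0 with ⟨h, _⟩ | ⟨h, _⟩ <;> rw [h]
        simp
      rw [hr] at h2
      linear_combination 2 * h2
    simp_rw [h1]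
    rw [Finset.sum_add_distrib, Finset.sum_sub_distrib, alg.sum_sq_ppart_r ht h0,
      ← Finset.mul_sum]
    ring
  have hgam : dotp (alg.m t) (alg.x t) - alg.gam t =
      (∑ i, ppart (alg.r t) i)⁻¹ * ∑ i, (alg.m t i - alg.gam t) * ppart (alg.r t) i := by
    have h1 : alg.gam t = ∑ i, alg.gam t * alg.x t i := by rw [← Finset.mul_sum, hx.2, mul_one]
    rw [dotp]
    conv_lhs => rw [h1]
    rw [← Finset.sum_sub_distrib, Finset.mul_sum]
    refine Finset.sum_congr rfl fun i _ => ?_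
    rw [alg.x_eq ht h0]
    ring
  have hlin : ∑ i, (alg.m t i - alg.gam t + alg.g t i) * p i =
      dotp (alg.u t) p - dotp (alg.u t) (alg.x t) +
        (dotp (alg.m t) (alg.x t) - alg.gam t) := by
    have h1 : dotp (alg.u t - alg.m t) (alg.x t) =
        dotp (alg.u t) (alg.x t) - dotp (alg.m t) (alg.x t) := by
      simp [dotp, sub_mul]
    calc _ = ∑ i, (alg.u t i * p i -
          (alg.gam t + dotp (alg.u t - alg.m t) (alg.x t)) * p i) :=
          Finset.sum_congr rfl fun i _ => by rw [hg]; ring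
      _ = _ := by
          rw [Finset.sum_sub_distrib, ← Finset.mul_sum, hp.2, h1]
          change dotp (alg.u t) p - _ = _
          ring
  have hlhs : ∑ i, 2 * ((alg.m t i - alg.gam t + alg.g t i) * (c * p i - ppart (alg.r t) i)) =
      2 * c * ∑ i, (alg.m t i - alg.gam t + alg.g t i) * p i -
        2 * ∑ i, (alg.m t i - alg.gam t) * ppart (alg.r t) i -
        2 * ∑ i, alg.g t i * ppart (alg.r t) i := by
    simp only [Finset.mul_sum, ← Finset.sum_sub_distrib]
    exact Finset.sum_congr rfl fun i _ => by ring
  rw [hlhs, hlin, hgam, alg.sum_g_mul_ppart_r ht h0, Finset.sum_add_distrib,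
    Finset.sum_sub_distrib, Finset.sum_sub_distrib] at key
  rw [← hres] at key ⊢
  linear_combination key

/-- One-step regret inequality in terms of the second-order path length and the prediction
error. -/
lemma regret_step_path {δ : ℝ} (hδ : 0 < δ) (hinit : δ ≤ l2 (alg.rt 1)) {t : ℕ} (ht : 1 ≤ t)
    {p : Fin d → ℝ} (hp : p ∈ stdSimplex ℝ (Fin d)) {c : ℝ} (hc : 0 ≤ c) :
    2 * c * (dotp (alg.u t) p - dotp (alg.u t) (alg.x t)) +
        c * (δ / (2 + 2 * d)) * l2 (alg.x t - alg.xt t) ^ 2 ≤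
      ∑ i, (c * p i - alg.rt t i) ^ 2 - ∑ i, (c * p i - alg.rt (t + 1) i) ^ 2 +
        (2 + 2 * d) * ∑ i, (alg.u t i - alg.m t i) ^ 2 := by
  have hlow := alg.sq_le_sum_sq_rt hδ hinit ht
  have h0 := ne_zero_of_le_sum_sq hδ hlow
  have ha := alg.sum_ppart_r_pos ht h0
  have hstep := alg.regret_step ht h0 hp hc
  have hg : ∑ i, alg.g t i ^ 2 ≤ (2 + 2 * d) * ∑ i, (alg.u t i - alg.m t i) ^ 2 := by
    simpa [alg.g_def t ht] using sum_sq_centered_le (alg.x_mem ht h0) (alg.u t - alg.m t)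
  have hδa : δ ≤ ∑ i, ppart (alg.r t) i := by
    rw [← alg.sum_sq_ppart_r ht h0] at hlow
    exact (sq_le_sq₀ hδ.le ha.le).1 (hlow.trans (sum_sq_le_sq_sum fun i => le_max_right _ _))
  have hpath := sum_sq_normalize_sub_le (w := ppart (alg.r t)) (alg.rt_nonneg ht) ha
    (alg.sum_rt_pos ht h0)
  simp_rw [← alg.x_eq ht h0, ← alg.xt_eq ht h0] at hpath
  have hl2 : l2 (alg.x t - alg.xt t) ^ 2 = ∑ i, (alg.x t i - alg.xt t i) ^ 2 := by
    simp [l2_sq]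
  rw [← hl2] at hpath
  have hd : (0 : ℝ) < 2 + 2 * d := by positivity
  have hres : δ / (2 + 2 * d) * l2 (alg.x t - alg.xt t) ^ 2 ≤
      (∑ i, ppart (alg.r t) i)⁻¹ * ∑ i, (ppart (alg.r t) i - alg.rt t i) ^ 2 := by
    rw [div_mul_eq_mul_div, div_le_iff₀ hd, mul_assoc, mul_comm (∑ i, _ ^ 2), inv_mul_eq_div,
      le_div_iff₀ ha]
    refine le_trans ?_ hpath
    nlinarith [mul_nonneg (mul_nonneg ha.le (sub_nonneg.2 hδa))
      (sq_nonneg (l2 (alg.x t - alg.xt t)))]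
  have := mul_le_mul_of_nonneg_left hres hc
  linarith

/-- Cumulative form of `regret_step_path`. -/
lemma regret_sum_path {δ : ℝ} (hδ : 0 < δ) (hinit : δ ≤ l2 (alg.rt 1)) {L : ℝ} {e : ℕ → ℝ}
    (he : ∀ t, 1 ≤ t → ∑ i, (alg.u t i - alg.m t i) ^ 2 ≤ L * e t)
    {p : Fin d → ℝ} (hp : p ∈ stdSimplex ℝ (Fin d)) {c : ℝ} (hc : 0 ≤ c) (T : ℕ) :
    2 * c * ∑ t ∈ Finset.Icc 1 T, (dotp (alg.u t) p - dotp (alg.u t) (alg.x t)) +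
        c * (δ / (2 + 2 * d)) * ∑ t ∈ Finset.Icc 1 T, l2 (alg.x t - alg.xt t) ^ 2 ≤
      2 * c ^ 2 + 2 * ∑ i, alg.rt 1 i ^ 2 +
        (2 + 2 * d) * L * ∑ t ∈ Finset.Icc 1 T, e t := by
  have hsum : 2 * c * ∑ t ∈ Finset.Icc 1 T, (dotp (alg.u t) p - dotp (alg.u t) (alg.x t)) +
        c * (δ / (2 + 2 * d)) * ∑ t ∈ Finset.Icc 1 T, l2 (alg.x t - alg.xt t) ^ 2 ≤
      ∑ i, (c * p i - alg.rt 1 i) ^ 2 - ∑ i, (c * p i - alg.rt (T + 1) i) ^ 2 +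
        (2 + 2 * d) * L * ∑ t ∈ Finset.Icc 1 T, e t := by
    induction T with
    | zero => simp
    | succ T ih =>
      have h1 := alg.regret_step_path hδ hinit (Nat.le_add_left 1 T) hp hc
      have h2 := mul_le_mul_of_nonneg_left (he (T + 1) (Nat.le_add_left 1 T))
        (by positivity : (0 : ℝ) ≤ 2 + 2 * d)
      simp only [Finset.sum_Icc_succ_top (Nat.le_add_left 1 T)]
      linarith
  have hstart : ∑ i, (c * p i - alg.rt 1 i) ^ 2 ≤ 2 * c ^ 2 + 2 * ∑ i, alg.rt 1 i ^ 2 := by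
    calc ∑ i, (c * p i - alg.rt 1 i) ^ 2
        ≤ ∑ i, (2 * c ^ 2 * p i ^ 2 + 2 * alg.rt 1 i ^ 2) :=
          Finset.sum_le_sum fun i _ => by nlinarith [sq_nonneg (c * p i + alg.rt 1 i)]
      _ = 2 * c ^ 2 * ∑ i, p i ^ 2 + 2 * ∑ i, alg.rt 1 i ^ 2 := by
          rw [Finset.sum_add_distrib, ← Finset.mul_sum, ← Finset.mul_sum]
      _ ≤ 2 * c ^ 2 * 1 + 2 * ∑ i, alg.rt 1 i ^ 2 := by gcongr; exact sum_sq_le_one hp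
      _ = _ := by ring
  have hend : 0 ≤ ∑ i, (c * p i - alg.rt (T + 1) i) ^ 2 :=
    Finset.sum_nonneg fun _ _ => sq_nonneg _
  linarith

end IRPRMp

/-- for IREG-PRM⁺ in self-play on a zero-sum game, if both
initial regret vectors have ℓ₂ norm at least `δ > 0`, the second-order path
length is bounded by a constant independent of `T`. -/
theorem stmt13
    {m n : ℕ} (A : Matrix (Fin m) (Fin n) ℝ)
    (algX : IRPRMp m) (algY : IRPRMp n)
    -- extragradient predictions and utilities (IREG-PRM⁺ self-play coupling)
    (hmX : ∀ t, 1 ≤ t → algX.rt t ≠ 0 → algX.m t = A *ᵥ algY.xt t)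
    (hmY : ∀ t, 1 ≤ t → algY.rt t ≠ 0 → algY.m t = -(Aᵀ *ᵥ algX.xt t))
    (huX : ∀ t, 1 ≤ t → algX.u t = A *ᵥ algY.x t)
    (huY : ∀ t, 1 ≤ t → algY.u t = -(Aᵀ *ᵥ algX.x t))
    (δ : ℝ) (hδ : 0 < δ)
    (hinitX : δ ≤ l2 (algX.rt 1)) (hinitY : δ ≤ l2 (algY.rt 1)) :
    ∃ C : ℝ, 0 ≤ C ∧ ∀ T : ℕ,
      ∑ t ∈ Finset.Icc 1 T,
          ((l2 (algX.x t - algX.xt t)) ^ 2 + (l2 (algY.x t - algY.xt t)) ^ 2)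
        ≤ C := by
  have hX0 : ∀ t, 1 ≤ t → algX.rt t ≠ 0 := fun t ht =>
    IRPRMp.ne_zero_of_le_sum_sq hδ (algX.sq_le_sum_sq_rt hδ hinitX ht)
  have hY0 : ∀ t, 1 ≤ t → algY.rt t ≠ 0 := fun t ht =>
    IRPRMp.ne_zero_of_le_sum_sq hδ (algY.sq_le_sum_sq_rt hδ hinitY ht)
  set L : ℝ := ∑ i, ∑ j, A i j ^ 2 with hL
  have hL0 : 0 ≤ L := Finset.sum_nonneg fun _ _ => Finset.sum_nonneg fun _ _ => sq_nonneg _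
  have heX : ∀ t, 1 ≤ t → ∑ i, (algX.u t i - algX.m t i) ^ 2 ≤
      L * l2 (algY.x t - algY.xt t) ^ 2 := fun t ht => by
    have h := sum_sq_mulVec_le A (algY.x t - algY.xt t)
    rw [l2_sq]
    simpa [huX t ht, hmX t ht (hX0 t ht), mulVec_sub] using h
  have heY : ∀ t, 1 ≤ t → ∑ i, (algY.u t i - algY.m t i) ^ 2 ≤
      L * l2 (algX.x t - algX.xt t) ^ 2 := fun t ht => by
    have h := sum_sq_mulVec_le Aᵀ (algX.xt t - algX.x t)
    simp only [transpose_apply] at h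
    rw [Finset.sum_comm, ← hL] at h
    have h1 : algY.u t - algY.m t = Aᵀ *ᵥ (algX.xt t - algX.x t) := by
      rw [huY t ht, hmY t ht (hY0 t ht), mulVec_sub]; abel
    have h2 : ∀ i, algY.u t i - algY.m t i = (Aᵀ *ᵥ (algX.xt t - algX.x t)) i :=
      fun i => congrFun h1 i
    simp_rw [h2]
    rw [l2_sq]
    refine h.trans_eq ?_
    congr 1
    exact Finset.sum_congr rfl fun i _ => by simp only [Pi.sub_apply]; ring
  set kX : ℝ := 2 + 2 * m
  set kY : ℝ := 2 + 2 * n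
  have hkX : 0 < kX := by positivity
  have hkY : 0 < kY := by positivity
  set c : ℝ := kX * (kY * L + 1) / δ + kY * (kX * L + 1) / δ with hcdef
  have hc : 0 ≤ c := by positivity
  have hcX : kY * L + 1 ≤ c * (δ / kX) := by
    have : c * (δ / kX) = kY * L + 1 + kY * (kX * L + 1) / kX := by rw [hcdef]; field_simp
    rw [this]
    exact le_add_of_nonneg_right (by positivity)
  have hcY : kX * L + 1 ≤ c * (δ / kY) := by
    have : c * (δ / kY) = kX * L + 1 + kX * (kY * L + 1) / kY := by
      rw [hcdef]; field_simp; ring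
    rw [this]
    exact le_add_of_nonneg_right (by positivity)
  set K : ℝ := 4 * c ^ 2 + 2 * ∑ i, algX.rt 1 i ^ 2 + 2 * ∑ i, algY.rt 1 i ^ 2 with hK
  have hK0 : 0 ≤ K := by positivity
  refine ⟨K, hK0, fun T => ?_⟩
  rcases T.eq_zero_or_pos with rfl | hT
  · simpa using hK0
  rw [Finset.sum_add_distrib]
  set SX := ∑ t ∈ Finset.Icc 1 T, l2 (algX.x t - algX.xt t) ^ 2 with hSX
  set SY := ∑ t ∈ Finset.Icc 1 T, l2 (algY.x t - algY.xt t) ^ 2 with hSY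
  have hSX0 : 0 ≤ SX := Finset.sum_nonneg fun _ _ => sq_nonneg _
  have hSY0 : 0 ≤ SY := Finset.sum_nonneg fun _ _ => sq_nonneg _
  let F : ℕ → ℕ → ℝ := fun s t => algX.x s ⬝ᵥ A *ᵥ algY.x t
  have hFX : ∀ s t, 1 ≤ t → dotp (algX.u t) (algX.x s) = F s t := fun s t ht => by
    rw [huX t ht]; exact dotProduct_comm _ _
  have hFY : ∀ s t, 1 ≤ t → dotp (algY.u t) (algY.x s) = -F t s := fun s t ht => by
    rw [huY t ht]
    change -(Aᵀ *ᵥ algX.x t) ⬝ᵥ algY.x s = -(algX.x t ⬝ᵥ A *ᵥ algY.x s)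
    rw [neg_dotProduct, mulVec_transpose, dotProduct_mulVec]
  have hbound : ∀ s ∈ Finset.Icc 1 T,
      2 * c * ∑ t ∈ Finset.Icc 1 T, (F s t - F t s) + (SX + SY) ≤ K := fun s hs => by
    have hs1 := (Finset.mem_Icc.1 hs).1
    have h1 := algX.regret_sum_path hδ hinitX heX (algX.x_mem hs1 (hX0 s hs1)) hc T
    have h2 := algY.regret_sum_path hδ hinitY heY (algY.x_mem hs1 (hY0 s hs1)) hc T
    have h3 : ∑ t ∈ Finset.Icc 1 T, (F s t - F t s) =
        ∑ t ∈ Finset.Icc 1 T,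
          (dotp (algX.u t) (algX.x s) - dotp (algX.u t) (algX.x t)) +
        ∑ t ∈ Finset.Icc 1 T,
          (dotp (algY.u t) (algY.x s) - dotp (algY.u t) (algY.x t)) := by
      rw [← Finset.sum_add_distrib]
      refine Finset.sum_congr rfl fun t ht => ?_
      have ht1 := (Finset.mem_Icc.1 ht).1
      rw [hFX s t ht1, hFX t t ht1, hFY s t ht1, hFY t t ht1]
      ring
    have h4 := mul_le_mul_of_nonneg_right hcX hSX0
    have h5 := mul_le_mul_of_nonneg_right hcY hSY0
    rw [h3]
    linarith
  have htotal := Finset.sum_le_sum hbound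
  have hanti : ∑ s ∈ Finset.Icc 1 T, ∑ t ∈ Finset.Icc 1 T, (F s t - F t s) = 0 := by
    simp only [Finset.sum_sub_distrib]
    rw [Finset.sum_comm, sub_self]
  rw [Finset.sum_add_distrib, ← Finset.mul_sum, hanti] at htotal
  simp only [mul_zero, zero_add, Finset.sum_const, Nat.card_Icc, Nat.add_sub_cancel,
    nsmul_eq_mul] at htotal
  exact le_of_mul_le_mul_left htotal (Nat.cast_pos.2 hT)
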